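/- Let K be an algebraically closed field (e.g., an algebraic closure of F_q), let α ∈ K, let g ∈ K[x] have degree at least one, and let n ≥ 1. Let C_n(α) be the set of n-tuples Γ = (γ₁, …, γ_n) ∈ K^n such that γ₁ = α and, if n ≥ 2, g(γ_i) = γ_{i−1} for 2 ≤ i ≤ n. Then ν(g^{(n)}(x) − α) ≤ max_{Γ ∈ C_n(α)} ∏_{i=1}^n ν(g(x) − γ_i), and ν*(g^{(n)}(x) − α) ≥ min_{Γ ∈ C_n(α)} ∏_{i=1}^n ν*(g(x) − γ_i). -/

import Mathlib

open Polynomial UniqueFactorizationMonoid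
open scoped Classical

/-- The `n`-th compositional iterate of a polynomial `g`. -/
noncomputable def iterPoly {K : Type*} [CommSemiring K] (g : Polynomial K) : ℕ → Polynomial K
  | 0 => X
  | n + 1 => g.comp (iterPoly g n)

/-- `P_n[f,g] = f(g^{(n)})`. -/
noncomputable def Pn {K : Type*} [CommSemiring K] (f g : Polynomial K) (n : ℕ) : Polynomial K :=
  f.comp (iterPoly g n)

/-- The finset of (normalized) monic irreducible factors of `P`. -/
noncomputable def irrFactors {K : Type*} [Field K] (P : Polynomial K) : Finset (Polynomial K) :=
  (normalizedFactors P).toFinset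

/-- Number of distinct irreducible factors of `P`. -/
noncomputable def Nfac {K : Type*} [Field K] (P : Polynomial K) : ℕ := (irrFactors P).card

/-- Degree of the squarefree part of `P`. -/
noncomputable def Dfac {K : Type*} [Field K] (P : Polynomial K) : ℕ :=
  ∑ r ∈ irrFactors P, r.natDegree

/-- Largest degree of an irreducible factor of `P`. -/
noncomputable def Mfac {K : Type*} [Field K] (P : Polynomial K) : ℕ :=
  (irrFactors P).sup natDegree

/-- Smallest degree of an irreducible factor of `P`. -/
noncomputable def mfac {K : Type*} [Field K] (P : Polynomial K) : ℕ :=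
  sInf {d | ∃ r ∈ irrFactors P, r.natDegree = d}

/-- Largest multiplicity in the irreducible factorization of `P`. -/
noncomputable def Efac {K : Type*} [Field K] (P : Polynomial K) : ℕ :=
  (irrFactors P).sup fun r => (normalizedFactors P).count r

/-- Smallest multiplicity in the irreducible factorization of `P`. -/
noncomputable def efac {K : Type*} [Field K] (P : Polynomial K) : ℕ :=
  sInf {e | ∃ r ∈ irrFactors P, (normalizedFactors P).count r = e}

/-- Largest multiplicity of a root of `P` in an algebraic closure. -/
noncomputable def nuMax {K : Type*} [Field K] (P : Polynomial K) : ℕ :=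
  Efac (P.map (algebraMap K (AlgebraicClosure K)))

/-- Smallest multiplicity of a root of `P` in an algebraic closure. -/
noncomputable def nuMin {K : Type*} [Field K] (P : Polynomial K) : ℕ :=
  efac (P.map (algebraMap K (AlgebraicClosure K)))

/-- The pair `(f, g)` is `p`-critical: `g = a x^{p^h} + b`. -/
def IsPCritical {K : Type*} [Field K] (p : ℕ) (_f g : Polynomial K) : Prop :=
  ∃ (h : ℕ) (a b : K), g = C a * X ^ p ^ h + C b

/-- The pair `(f, g)` is critical: `f = β (x-α)^{deg f}` and `g = γ (x-α)^{deg g} + α`. -/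
def IsCritical {K : Type*} [Field K] (f g : Polynomial K) : Prop :=
  ∃ α β γ : K, f = C β * (X - C α) ^ f.natDegree ∧
    g = C γ * (X - C α) ^ g.natDegree + C α

namespace Polynomial

variable {K : Type*} [Field K]

theorem sub_C_ne_zero_of_natDegree_pos {g : K[X]} (hg : 1 ≤ g.natDegree) (c : K) :
    g - C c ≠ 0 := by
  intro h0
  have := natDegree_sub_C (p := g) (a := c)
  rw [h0, natDegree_zero] at this
  omega

theorem rootMultiplicity_comp_of_natDegree_pos {f h : K[X]} (hf : f ≠ 0) (hh : 1 ≤ h.natDegree)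
    (b : K) :
    rootMultiplicity b (f.comp h) =
      rootMultiplicity (eval b h) f * rootMultiplicity b (h - C (eval b h)) := by
  obtain ⟨q, hq, hnd⟩ := exists_eq_pow_rootMultiplicity_mul_and_not_dvd f hf (eval b h)
  rw [dvd_iff_isRoot] at hnd
  set m := rootMultiplicity (eval b h) f
  have hne := sub_C_ne_zero_of_natDegree_pos hh (eval b h)
  have hroot : ¬ IsRoot (q.comp h) b := by simpa [IsRoot, eval_comp] using hnd
  have hq0 : q.comp h ≠ 0 := fun h0 => hroot (by simp [h0])
  have hcomp : f.comp h = (h - C (eval b h)) ^ m * q.comp h := by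
    conv_lhs => rw [hq]
    simp [mul_comp]
  rw [hcomp, rootMultiplicity_mul (mul_ne_zero (pow_ne_zero _ hne) hq0),
    rootMultiplicity_eq_zero hroot, add_zero, ← count_roots, ← count_roots, roots_pow,
    Multiset.count_nsmul]

theorem count_normalizedFactors_X_sub_C {P : K[X]} (hP : P ≠ 0) (a : K) :
    (normalizedFactors P).count (X - C a) = rootMultiplicity a P :=
  count_normalizedFactors_eq (irreducible_X_sub_C a) (monic_X_sub_C a).normalize_eq_self
    (pow_rootMultiplicity_dvd P a) (pow_rootMultiplicity_not_dvd hP a)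

end Polynomial

section

variable {K : Type*} [Field K]

theorem X_sub_C_mem_irrFactors {P : K[X]} (hP : P ≠ 0) {a : K} (ha : IsRoot P a) :
    X - C a ∈ irrFactors P := by
  rw [irrFactors, Multiset.mem_toFinset, ← Multiset.count_pos, count_normalizedFactors_X_sub_C hP]
  exact (rootMultiplicity_pos hP).2 ha

theorem exists_isRoot_of_mem_irrFactors [IsAlgClosed K] {P r : K[X]} (hP : P ≠ 0)
    (hr : r ∈ irrFactors P) :
    ∃ a, IsRoot P a ∧ (normalizedFactors P).count r = rootMultiplicity a P := by
  rw [irrFactors, Multiset.mem_toFinset] at hr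
  have hirr := irreducible_of_normalized_factor r hr
  have hmonic : r.Monic := by
    rw [← normalize_normalized_factor r hr]
    exact monic_normalize hirr.ne_zero
  have hr' : r = X - C (-r.coeff 0) := by
    rw [C_neg, sub_neg_eq_add]
    exact hmonic.eq_X_add_C
      (natDegree_eq_of_degree_eq_some (IsAlgClosed.degree_eq_one_of_irreducible K hirr))
  refine ⟨-r.coeff 0, ?_, ?_⟩
  · rw [← dvd_iff_isRoot, ← hr']
    exact dvd_of_mem_normalizedFactors hr
  · rw [← count_normalizedFactors_X_sub_C hP, ← hr']

theorem rootMultiplicity_le_Efac {P : K[X]} (hP : P ≠ 0) {a : K} (ha : IsRoot P a) :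
    rootMultiplicity a P ≤ Efac P := by
  rw [← count_normalizedFactors_X_sub_C hP]
  exact Finset.le_sup (f := fun r => (normalizedFactors P).count r) (X_sub_C_mem_irrFactors hP ha)

theorem efac_le_rootMultiplicity {P : K[X]} (hP : P ≠ 0) {a : K} (ha : IsRoot P a) :
    efac P ≤ rootMultiplicity a P :=
  Nat.sInf_le ⟨_, X_sub_C_mem_irrFactors hP ha, count_normalizedFactors_X_sub_C hP a⟩

theorem Efac_le_natDegree [IsAlgClosed K] {P : K[X]} (hP : P ≠ 0) : Efac P ≤ P.natDegree := by
  refine Finset.sup_le fun r hr => ?_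
  obtain ⟨a, -, h⟩ := exists_isRoot_of_mem_irrFactors hP hr
  rw [h, ← count_roots]
  exact (Multiset.count_le_card _ _).trans (card_roots' P)

theorem natDegree_iterPoly (g : K[X]) (n : ℕ) : (iterPoly g n).natDegree = g.natDegree ^ n := by
  induction n with
  | zero => simp [iterPoly]
  | succ n ih => rw [iterPoly, natDegree_comp, ih, pow_succ']

theorem rootMultiplicity_iterPoly_sub_C {g : K[X]} (hg : 1 ≤ g.natDegree) (b : K) (n : ℕ) :
    rootMultiplicity b (iterPoly g n - C (eval b (iterPoly g n))) =
      ∏ k ∈ Finset.range n, rootMultiplicity (eval b (iterPoly g k))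
        (g - C (eval b (iterPoly g (k + 1)))) := by
  induction n with
  | zero => simp [iterPoly, rootMultiplicity_X_sub_C_self]
  | succ n ih =>
    have hcomp : iterPoly g (n + 1) - C (eval b (iterPoly g (n + 1))) =
        (g - C (eval b (iterPoly g (n + 1)))).comp (iterPoly g n) := by
      simp [iterPoly]
    rw [Finset.prod_range_succ, ← ih, hcomp, rootMultiplicity_comp_of_natDegree_pos
      (sub_C_ne_zero_of_natDegree_pos hg _)
      (by rw [natDegree_iterPoly]; exact Nat.one_le_pow _ _ hg), mul_comm]

/-- A point `b` with `g^{(n)}(b) = α` determines a backward orbit `Γ` of `α`, along which the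
multiplicity of `b` is a product of multiplicities of roots of the polynomials `g - Γ i`. -/
theorem exists_backward_orbit {g : K[X]} (hg : 1 ≤ g.natDegree) {α b : K} {n : ℕ} (hn : 1 ≤ n)
    (hb : eval b (iterPoly g n) = α) :
    ∃ Γ β : Fin n → K, Γ ⟨0, hn⟩ = α ∧
      (∀ i j : Fin n, (j : ℕ) + 1 = (i : ℕ) → eval (Γ i) g = Γ j) ∧
      (∀ i, IsRoot (g - C (Γ i)) (β i)) ∧
      rootMultiplicity b (iterPoly g n - C α) = ∏ i, rootMultiplicity (β i) (g - C (Γ i)) := by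
  have hstep (k : ℕ) : eval (eval b (iterPoly g k)) g = eval b (iterPoly g (k + 1)) := by
    simp [iterPoly, eval_comp]
  refine ⟨fun i => eval b (iterPoly g (n - 1 - i + 1)), fun i => eval b (iterPoly g (n - 1 - i)),
    ?_, ?_, ?_, ?_⟩
  · simpa [Nat.sub_add_cancel hn] using hb
  · intro i j hij
    have := i.isLt
    simp only
    rw [hstep, show n - 1 - (i : ℕ) + 1 = n - 1 - j by omega]
  · intro i
    simp [IsRoot, hstep]
  · rw [← hb, rootMultiplicity_iterPoly_sub_C hg, ← Finset.prod_range_reflect]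
    exact (Fin.prod_univ_eq_prod_range (fun i => rootMultiplicity (eval b (iterPoly g (n - 1 - i)))
      (g - C (eval b (iterPoly g (n - 1 - i + 1))))) n).symm

end

theorem stmt12 {K : Type*} [Field K] [IsAlgClosed K] (α : K) (g : Polynomial K)
    (hg : 1 ≤ g.natDegree) (n : ℕ) (hn : 1 ≤ n) :
    Efac (iterPoly g n - C α) ≤
      sSup {m : ℕ | ∃ Γ : Fin n → K, Γ ⟨0, hn⟩ = α ∧
        (∀ i j : Fin n, (j : ℕ) + 1 = (i : ℕ) → eval (Γ i) g = Γ j) ∧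
        m = ∏ i, Efac (g - C (Γ i))} ∧
    sInf {m : ℕ | ∃ Γ : Fin n → K, Γ ⟨0, hn⟩ = α ∧
        (∀ i j : Fin n, (j : ℕ) + 1 = (i : ℕ) → eval (Γ i) g = Γ j) ∧
        m = ∏ i, efac (g - C (Γ i))} ≤ efac (iterPoly g n - C α) := by
  have hg' := sub_C_ne_zero_of_natDegree_pos hg
  have hdeg : 1 ≤ (iterPoly g n).natDegree := by
    rw [natDegree_iterPoly]
    exact Nat.one_le_pow _ _ hg
  have hP := sub_C_ne_zero_of_natDegree_pos hdeg α
  constructor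
  · refine Finset.sup_le fun r hr => ?_
    obtain ⟨b, hb, hcount⟩ := exists_isRoot_of_mem_irrFactors hP hr
    obtain ⟨Γ, β, h0, hΓ, hβ, hprod⟩ :=
      exists_backward_orbit hg hn (sub_eq_zero.1 (by simpa [IsRoot] using hb))
    rw [hcount, hprod]
    refine (Finset.prod_le_prod' fun i _ => rootMultiplicity_le_Efac (hg' _) (hβ i)).trans
      (le_csSup ⟨g.natDegree ^ n, ?_⟩ ⟨Γ, h0, hΓ, rfl⟩)
    rintro _ ⟨Δ, -, -, rfl⟩
    calc ∏ i, Efac (g - C (Δ i)) ≤ ∏ _i : Fin n, g.natDegree :=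
          Finset.prod_le_prod' fun i _ => (Efac_le_natDegree (hg' _)).trans natDegree_sub_C.le
      _ = g.natDegree ^ n := by simp
  · obtain ⟨a, ha⟩ := IsAlgClosed.exists_root (iterPoly g n - C α)
      (natDegree_pos_iff_degree_pos.1 (by rwa [natDegree_sub_C])).ne'
    obtain ⟨r, hr, hcount'⟩ := Nat.sInf_mem (s := {e | ∃ r ∈ irrFactors (iterPoly g n - C α),
      (normalizedFactors (iterPoly g n - C α)).count r = e}) ⟨_, _, X_sub_C_mem_irrFactors hP ha, rfl⟩
    obtain ⟨b, hb, hcount⟩ := exists_isRoot_of_mem_irrFactors hP hr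
    obtain ⟨Γ, β, h0, hΓ, hβ, hprod⟩ :=
      exists_backward_orbit hg hn (sub_eq_zero.1 (by simpa [IsRoot] using hb))
    rw [efac, ← hcount', hcount, hprod]
    exact le_trans (Nat.sInf_le ⟨Γ, h0, hΓ, rfl⟩)
      (Finset.prod_le_prod' fun i _ => efac_le_rootMultiplicity (hg' _) (hβ i))
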